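/- arXiv:2412.00236 — 6 statements merged into one kernel-verified Lean document; each statement's English description precedes it below -/
import Mathlib

section
/- Let 0 < α < 2 with α ≠ 1, and for a positive integer n and x ∈ ℝ set I_n(x) = ∫₀^{2π} (sin(nx) − sin(nx − ny)) / (sin(y/2))^α dy and J_n(x) = ∫₀^{2π} (cos(nx) − cos(nx − ny)) / (sin(y/2))^α dy. Then I_n(x) = β_n sin(nx) and J_n(x) = β_n cos(nx) for all x, where β_n = 2^α · (2π Γ(1−α))/(Γ(α/2) Γ(1−α/2)) · ( Γ(α/2)/Γ(1−α/2) − Γ(n+α/2)/Γ(n+1−α/2) ). -/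
open Real MeasureTheory intervalIntegral

/-- The substitution `u = (1 - cos t) / 2` maps `(0, π)` onto `(0, 1)`. -/
lemma image_one_sub_cos_div_two_Ioo :
    (fun t : ℝ => (1 - cos t) / 2) '' Set.Ioo 0 π = Set.Ioo 0 1 := by
  ext u
  constructor
  · rintro ⟨t, ht, rfl⟩
    have h1 : cos t < cos 0 :=
      strictAntiOn_cos ⟨le_rfl, pi_pos.le⟩ ⟨ht.1.le, ht.2.le⟩ ht.1
    have h2 : cos π < cos t :=
      strictAntiOn_cos ⟨ht.1.le, ht.2.le⟩ ⟨pi_pos.le, le_rfl⟩ ht.2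
    rw [cos_zero] at h1
    rw [cos_pi] at h2
    constructor <;> simp only <;> linarith
  · rintro ⟨h0, h1⟩
    refine ⟨arccos (1 - 2 * u), ⟨arccos_pos.2 (by linarith), ?_⟩, ?_⟩
    · refine lt_of_le_of_ne (arccos_le_pi _) fun h => ?_
      have := arccos_eq_pi.1 h
      linarith
    · simp only
      rw [cos_arccos (by linarith) (by linarith)]
      ring

lemma hasDerivAt_one_sub_cos_div_two (t : ℝ) :
    HasDerivAt (fun t : ℝ => (1 - cos t) / 2) (sin t / 2) t := by
  simpa using ((hasDerivAt_cos t).const_sub 1).div_const 2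

lemma injOn_one_sub_cos_div_two :
    Set.InjOn (fun t : ℝ => (1 - cos t) / 2) (Set.Ioo 0 π) := by
  intro a ha b hb h
  refine injOn_cos ⟨ha.1.le, ha.2.le⟩ ⟨hb.1.le, hb.2.le⟩ ?_
  simp only at h
  linarith

/-- The integrand of the Beta integral `B((r + 1) / 2, (r + 1) / 2)` after the substitution
`u = (1 - cos t) / 2`. -/
lemma abs_sin_div_two_smul_beta_integrand (r : ℝ) {t : ℝ} (ht : t ∈ Set.Ioo 0 π) :
    |sin t / 2| • ((((1 - cos t) / 2 : ℝ) : ℂ) ^ ((((r + 1) / 2 : ℝ) : ℂ) - 1) *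
      (1 - (((1 - cos t) / 2 : ℝ) : ℂ)) ^ ((((r + 1) / 2 : ℝ) : ℂ) - 1)) =
      (((2 : ℝ) ^ (-r) * sin t ^ r : ℝ) : ℂ) := by
  have hs : 0 < sin t := sin_pos_of_pos_of_lt_pi ht.1 ht.2
  have hu : 0 ≤ (1 - cos t) / 2 := by linarith [cos_le_one t]
  have hv : 0 ≤ 1 - (1 - cos t) / 2 := by linarith [neg_one_le_cos t]
  have key : |sin t / 2| * (((1 - cos t) / 2) ^ ((r + 1) / 2 - 1) *
      (1 - (1 - cos t) / 2) ^ ((r + 1) / 2 - 1)) = 2 ^ (-r) * sin t ^ r := by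
    rw [abs_of_pos (by positivity), ← mul_rpow hu hv]
    have h1 : (1 - cos t) / 2 * (1 - (1 - cos t) / 2) = (sin t / 2) ^ (2 : ℝ) := by
      rw [rpow_two]
      nlinarith [sin_sq_add_cos_sq t]
    rw [h1, ← rpow_mul (by positivity), rpow_neg zero_le_two, ← div_eq_inv_mul,
      ← div_rpow hs.le zero_le_two]
    nth_rewrite 1 [← rpow_one (sin t / 2)]
    rw [← rpow_add (by positivity)]
    congr 1
    ring
  rw [← key, Complex.real_smul]
  push_cast [Complex.ofReal_cpow hu, Complex.ofReal_cpow hv]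
  rfl

lemma integrableOn_sin_rpow {r : ℝ} (hr : -1 < r) :
    IntegrableOn (fun t => sin t ^ r) (Set.Ioo 0 π) := by
  have hp : 0 < (((r + 1) / 2 : ℝ) : ℂ).re := by rw [Complex.ofReal_re]; linarith
  have h := (intervalIntegrable_iff_integrableOn_Ioo_of_le zero_le_one).1
    (Complex.betaIntegral_convergent hp hp)
  rw [← image_one_sub_cos_div_two_Ioo, integrableOn_image_iff_integrableOn_abs_deriv_smul
    measurableSet_Ioo (fun x _ => (hasDerivAt_one_sub_cos_div_two x).hasDerivWithinAt)
    injOn_one_sub_cos_div_two, integrableOn_congr_fun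
    (fun t ht => abs_sin_div_two_smul_beta_integrand r ht) measurableSet_Ioo] at h
  have h2 := (h.re).const_mul ((2 : ℝ) ^ r)
  refine h2.congr (Filter.Eventually.of_forall fun t => ?_)
  simp only [RCLike.re_to_complex, Complex.ofReal_re]
  rw [rpow_neg zero_le_two, mul_inv_cancel_left₀ (by positivity)]

lemma integral_sin_rpow_eq_Gamma {r : ℝ} (hr : -1 < r) :
    ∫ t in (0 : ℝ)..π, sin t ^ r = 2 ^ r * (Gamma ((r + 1) / 2) ^ 2 / Gamma (r + 1)) := by
  have hp : 0 < (r + 1) / 2 := by linarith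
  have h := ProbabilityTheory.beta_eq_betaIntegralReal _ _ hp hp
  rw [Complex.betaIntegral, integral_of_le zero_le_one, integral_Ioc_eq_integral_Ioo,
    ← image_one_sub_cos_div_two_Ioo, integral_image_eq_integral_abs_deriv_smul
    measurableSet_Ioo (fun x _ => (hasDerivAt_one_sub_cos_div_two x).hasDerivWithinAt)
    injOn_one_sub_cos_div_two, setIntegral_congr_fun measurableSet_Ioo
    (fun t ht => abs_sin_div_two_smul_beta_integrand r ht), integral_complex_ofReal,
    Complex.ofReal_re, MeasureTheory.integral_const_mul, ← integral_Ioc_eq_integral_Ioo,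
    ← integral_of_le pi_pos.le, ProbabilityTheory.beta, add_halves] at h
  rw [sq, h, rpow_neg zero_le_two, mul_inv_cancel_left₀ (by positivity)]

lemma intervalIntegrable_mul_sin_rpow {r : ℝ} (hr : -1 < r) {g : ℝ → ℝ} (hg : Continuous g) :
    IntervalIntegrable (fun t => g t * sin t ^ r) volume 0 π :=
  ((intervalIntegrable_iff_integrableOn_Ioo_of_le pi_pos.le).2
    (integrableOn_sin_rpow hr)).continuousOn_mul hg.continuousOn

/-- Integration by parts against `sin ^ s`. -/
lemma integral_sin_odd_mul_sin_rpow_succ {s : ℝ} (hs : 0 < s) (n : ℕ) :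
    (n + 1 + s / 2) * ∫ t in (0 : ℝ)..π, sin ((2 * (n + 1 : ℕ) + 1) * t) * sin t ^ (s - 1) =
      (n + 1 - s / 2) * ∫ t in (0 : ℝ)..π, sin ((2 * n + 1) * t) * sin t ^ (s - 1) := by
  have hr : -1 < s - 1 := by linarith
  have hF : ∫ t in (0 : ℝ)..π, ((n + 1 + s / 2) * (sin ((2 * (n + 1 : ℕ) + 1) * t) *
      sin t ^ (s - 1)) - (n + 1 - s / 2) * (sin ((2 * n + 1) * t) * sin t ^ (s - 1))) =
      sin π ^ s * sin (2 * (n + 1) * π) - sin 0 ^ s * sin (2 * (n + 1) * 0) := by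
    refine integral_eq_sub_of_hasDerivAt_of_le (f := fun t => sin t ^ s * sin (2 * (n + 1) * t))
      pi_pos.le ?_ ?_ ?_
    · exact ((continuous_sin.rpow_const fun _ => Or.inr hs.le).mul
        (continuous_sin.comp (continuous_const.mul continuous_id))).continuousOn
    · intro t ht
      have hst : 0 < sin t := sin_pos_of_pos_of_lt_pi ht.1 ht.2
      have h1 := (hasDerivAt_sin t).rpow_const (p := s) (Or.inl hst.ne')
      have h2 : HasDerivAt (fun t : ℝ => sin (2 * (n + 1) * t))
          (cos (2 * (n + 1) * t) * (2 * (n + 1))) t := by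
        simpa using ((hasDerivAt_id t).const_mul (2 * ((n : ℝ) + 1))).sin
      refine (h1.mul h2).congr_deriv ?_
      have h3 : sin t ^ s = sin t ^ (s - 1) * sin t := by
        rw [← rpow_add_one hst.ne', sub_add_cancel]
      have h4 : (2 * ((n + 1 : ℕ) : ℝ) + 1) * t = 2 * (n + 1) * t + t := by push_cast; ring
      have h5 : (2 * (n : ℝ) + 1) * t = 2 * (n + 1) * t - t := by ring
      rw [h3, h4, h5, sin_add, sin_sub]
      ring
    · exact ((intervalIntegrable_mul_sin_rpow hr (by fun_prop)).const_mul _).sub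
        ((intervalIntegrable_mul_sin_rpow hr (by fun_prop)).const_mul _)
  rw [integral_sub ((intervalIntegrable_mul_sin_rpow hr (by fun_prop)).const_mul _)
    ((intervalIntegrable_mul_sin_rpow hr (by fun_prop)).const_mul _),
    intervalIntegral.integral_const_mul, intervalIntegral.integral_const_mul, sin_pi, sin_zero,
    zero_rpow hs.ne'] at hF
  linarith

lemma integral_sin_odd_mul_sin_rpow {α : ℝ} (hα0 : 0 < α) (hα2 : α < 2) (n : ℕ) :
    ∫ t in (0 : ℝ)..π, sin ((2 * n + 1) * t) * sin t ^ (1 - α) =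
      2 ^ (α - 1) * π * Gamma (2 - α) / (Gamma (α / 2) * Gamma (1 - α / 2)) *
        (Gamma (n + α / 2) / Gamma (n + 2 - α / 2)) := by
  induction n with
  | zero =>
    have h0 : ∫ t in (0 : ℝ)..π, sin ((2 * (0 : ℕ) + 1) * t) * sin t ^ (1 - α) =
        ∫ t in (0 : ℝ)..π, sin t ^ (2 - α) := by
      refine integral_congr fun t ht => ?_
      rw [Set.uIcc_of_le pi_pos.le] at ht
      have hst : 0 ≤ sin t := sin_nonneg_of_nonneg_of_le_pi ht.1 ht.2
      simp only [Nat.cast_zero, mul_zero, zero_add, one_mul]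
      rw [mul_comm, ← rpow_add_one' hst (by linarith)]
      congr 1
      ring
    rw [h0, integral_sin_rpow_eq_Gamma (by linarith)]
    have d1 := Gamma_mul_Gamma_add_half (1 - α / 2)
    have d2 := Gamma_mul_Gamma_add_half ((2 - α + 1) / 2)
    rw [show 1 - α / 2 + 1 / 2 = (2 - α + 1) / 2 by ring,
      show 2 * (1 - α / 2) = 2 - α by ring] at d1
    rw [show (2 - α + 1) / 2 + 1 / 2 = 2 - α / 2 by ring,
      show 2 * ((2 - α + 1) / 2) = 2 - α + 1 by ring] at d2
    have g1 : 0 < Gamma (1 - α / 2) := Gamma_pos_of_pos (by linarith)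
    have g2 : 0 < Gamma (2 - α / 2) := Gamma_pos_of_pos (by linarith)
    have g3 : 0 < Gamma (2 - α + 1) := Gamma_pos_of_pos (by linarith)
    have g4 : 0 < Gamma (α / 2) := Gamma_pos_of_pos (by linarith)
    have hpow : (2 : ℝ) ^ (2 - α) * (2 ^ (1 - (2 - α)) * 2 ^ (1 - (2 - α + 1))) =
        2 ^ (α - 1) := by
      rw [← rpow_add two_pos, ← rpow_add two_pos]
      congr 1
      ring
    have hpi : √π * √π = π := mul_self_sqrt pi_pos.le
    have key : Gamma ((2 - α + 1) / 2) ^ 2 * (Gamma (1 - α / 2) * Gamma (2 - α / 2)) =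
        Gamma (2 - α) * Gamma (2 - α + 1) *
          (2 ^ (1 - (2 - α)) * 2 ^ (1 - (2 - α + 1))) * π := by
      linear_combination (Gamma ((2 - α + 1) / 2) * Gamma (2 - α / 2)) * d1 +
        (Gamma (2 - α) * 2 ^ (1 - (2 - α)) * √π) * d2 +
        (Gamma (2 - α) * Gamma (2 - α + 1) *
          (2 ^ (1 - (2 - α)) * 2 ^ (1 - (2 - α + 1)))) * hpi
    rw [← hpow]
    simp only [Nat.cast_zero, zero_add]
    generalize Gamma (1 - α / 2) = G₁ at *
    generalize Gamma (2 - α / 2) = G₂ at *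
    generalize Gamma (2 - α + 1) = G₃ at *
    generalize Gamma (α / 2) = G₄ at *
    generalize (2 : ℝ) ^ (1 - (2 - α)) * 2 ^ (1 - (2 - α + 1)) = P at *
    field_simp
    linear_combination key
  | succ n ih =>
    have h := integral_sin_odd_mul_sin_rpow_succ (s := 2 - α) (by linarith) n
    rw [show 2 - α - 1 = 1 - α by ring, ih] at h
    have hn : (0 : ℝ) ≤ n := n.cast_nonneg
    have e1 : Gamma ((n + 1 : ℕ) + α / 2) = (n + α / 2) * Gamma (n + α / 2) := by
      rw [← Gamma_add_one (by positivity)]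
      congr 1
      push_cast
      ring
    have hne : n + 2 - α / 2 ≠ 0 := by linarith
    have e2 : Gamma ((n + 1 : ℕ) + 2 - α / 2) = (n + 2 - α / 2) * Gamma (n + 2 - α / 2) := by
      rw [← Gamma_add_one hne]
      congr 1
      push_cast
      ring
    have hne' : (n : ℝ) + 1 + (2 - α) / 2 ≠ 0 := by linarith
    refine mul_left_cancel₀ hne' (h.trans ?_)
    have g1 : Gamma (n + 2 - α / 2) ≠ 0 := (Gamma_pos_of_pos (by linarith)).ne'
    rw [e1, e2, show (n : ℝ) + 1 + (2 - α) / 2 = n + 2 - α / 2 by ring,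
      show (n : ℝ) + 1 - (2 - α) / 2 = n + α / 2 by ring]
    generalize Gamma (n + 2 - α / 2) = G at *
    generalize (n : ℝ) + 2 - α / 2 = c at *
    field_simp

lemma integral_cos_odd_mul_sin_rpow (r : ℝ) (k : ℕ) :
    ∫ t in (0 : ℝ)..π, cos ((2 * k + 1) * t) * sin t ^ r = 0 := by
  have h := integral_comp_sub_left (fun t => cos ((2 * k + 1) * t) * sin t ^ r)
    (a := 0) (b := π) π
  have h2 : ∀ t : ℝ, cos ((2 * k + 1) * (π - t)) * sin (π - t) ^ r =
      -(cos ((2 * k + 1) * t) * sin t ^ r) := by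
    intro t
    rw [sin_pi_sub, show (2 * k + 1) * (π - t) = (π - (2 * k + 1) * t) + k * (2 * π) by ring,
      cos_add_nat_mul_two_pi, cos_pi_sub]
    ring
  simp only [h2, sub_self, sub_zero, intervalIntegral.integral_neg] at h
  linarith

lemma sum_sin_odd_mul_sin (n : ℕ) (t : ℝ) :
    1 - cos (n * (2 * t)) = (2 * ∑ k ∈ Finset.range n, sin ((2 * k + 1) * t)) * sin t := by
  induction n with
  | zero => simp
  | succ n ih =>
    rw [Finset.sum_range_succ, mul_add, add_mul, ← ih]
    have h1 : ((n + 1 : ℕ) : ℝ) * (2 * t) = (2 * n + 1) * t + t := by push_cast; ring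
    have h2 : (n : ℝ) * (2 * t) = (2 * n + 1) * t - t := by ring
    rw [h1, h2, cos_add, cos_sub]
    ring

lemma sum_cos_odd_mul_sin (n : ℕ) (t : ℝ) :
    sin (n * (2 * t)) = (2 * ∑ k ∈ Finset.range n, cos ((2 * k + 1) * t)) * sin t := by
  induction n with
  | zero => simp
  | succ n ih =>
    rw [Finset.sum_range_succ, mul_add, add_mul, ← ih]
    have h1 : ((n + 1 : ℕ) : ℝ) * (2 * t) = (2 * n + 1) * t + t := by push_cast; ring
    have h2 : (n : ℝ) * (2 * t) = (2 * n + 1) * t - t := by ring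
    rw [h1, h2, sin_add, sin_sub]
    ring

lemma sum_Gamma_ratio {α : ℝ} (hα0 : 0 < α) (hα2 : α < 2) (n : ℕ) :
    (1 - α) * ∑ k ∈ Finset.range n, Gamma (k + α / 2) / Gamma (k + 2 - α / 2) =
      Gamma (α / 2) / Gamma (1 - α / 2) - Gamma (n + α / 2) / Gamma (n + 1 - α / 2) := by
  induction n with
  | zero => simp
  | succ n ih =>
    rw [Finset.sum_range_succ, mul_add, ih]
    have hn : (0 : ℝ) ≤ n := n.cast_nonneg
    have e1 : Gamma ((n + 1 : ℕ) + α / 2) = (n + α / 2) * Gamma (n + α / 2) := by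
      rw [← Gamma_add_one (by positivity)]
      congr 1
      push_cast
      ring
    have hne : n + 1 - α / 2 ≠ 0 := by linarith
    have e2 : Gamma (n + 2 - α / 2) = (n + 1 - α / 2) * Gamma (n + 1 - α / 2) := by
      rw [← Gamma_add_one hne]
      congr 1
      ring
    have e3 : ((n + 1 : ℕ) : ℝ) + 1 - α / 2 = n + 2 - α / 2 := by push_cast; ring
    have g1 : Gamma (n + 1 - α / 2) ≠ 0 := (Gamma_pos_of_pos (by linarith)).ne'
    have g2 : Gamma (1 - α / 2) ≠ 0 := (Gamma_pos_of_pos (by linarith)).ne'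
    rw [e3, e1, e2]
    generalize Gamma (n + 1 - α / 2) = G at *
    generalize Gamma (1 - α / 2) = G₁ at *
    have hne2 : 2 * ((n : ℝ) + 1) - α ≠ 0 := fun h => hne (by linarith)
    field_simp
    ring

/-- The common form of both integrals: the even part of the kernel contributes the eigenvalue,
the odd part integrates to zero. -/
lemma integral_singular_kernel {α : ℝ} (hα0 : 0 < α) (hα2 : α < 2) (hα1 : α ≠ 1) (n : ℕ)
    (A B : ℝ) :
    ∫ y in (0 : ℝ)..(2 * π), (A * (1 - cos (n * y)) + B * sin (n * y)) / sin (y / 2) ^ α =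
      2 ^ α * (2 * π * Gamma (1 - α) / (Gamma (α / 2) * Gamma (1 - α / 2))) *
        (Gamma (α / 2) / Gamma (1 - α / 2) - Gamma (n + α / 2) / Gamma (n + 1 - α / 2)) * A := by
  have hr : -1 < 1 - α := by linarith
  have hsub := integral_comp_div
    (fun t => (A * (1 - cos (n * (2 * t))) + B * sin (n * (2 * t))) / sin t ^ α)
    (a := 0) (b := 2 * π) (c := 2) two_ne_zero
  simp only [mul_div_cancel₀ _ (two_ne_zero' ℝ), mul_div_cancel_left₀ _ (two_ne_zero' ℝ),
    zero_div] at hsub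
  have hcongr : ∫ t in (0 : ℝ)..π,
      (A * (1 - cos (n * (2 * t))) + B * sin (n * (2 * t))) / sin t ^ α =
      ∫ t in (0 : ℝ)..π, (∑ k ∈ Finset.range n,
        (2 * A * (sin ((2 * k + 1) * t) * sin t ^ (1 - α)) +
          2 * B * (cos ((2 * k + 1) * t) * sin t ^ (1 - α)))) := by
    rw [integral_of_le pi_pos.le, integral_of_le pi_pos.le, integral_Ioc_eq_integral_Ioo,
      integral_Ioc_eq_integral_Ioo]
    refine setIntegral_congr_fun measurableSet_Ioo fun t ht => ?_
    have hst : 0 < sin t := sin_pos_of_pos_of_lt_pi ht.1 ht.2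
    rw [sum_sin_odd_mul_sin, sum_cos_odd_mul_sin, rpow_sub hst, rpow_one,
      Finset.sum_add_distrib, ← Finset.mul_sum, ← Finset.mul_sum, ← Finset.sum_mul,
      ← Finset.sum_mul]
    ring
  have hS : ∀ k : ℕ, IntervalIntegrable
      (fun t => 2 * A * (sin ((2 * k + 1) * t) * sin t ^ (1 - α))) volume 0 π := fun k =>
    (intervalIntegrable_mul_sin_rpow hr (by fun_prop)).const_mul _
  have hC : ∀ k : ℕ, IntervalIntegrable
      (fun t => 2 * B * (cos ((2 * k + 1) * t) * sin t ^ (1 - α))) volume 0 π := fun k =>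
    (intervalIntegrable_mul_sin_rpow hr (by fun_prop)).const_mul _
  have hΓ : Gamma (2 - α) = (1 - α) * Gamma (1 - α) := by
    rw [← Gamma_add_one (sub_ne_zero.2 hα1.symm)]
    congr 1
    ring
  have hpow : (2 : ℝ) ^ α = 2 ^ (α - 1) * 2 := by
    rw [← rpow_add_one two_ne_zero, sub_add_cancel]
  rw [hsub, hcongr, intervalIntegral.integral_finsetSum fun k _ => (hS k).add (hC k)]
  simp only [integral_add (hS _) (hC _), intervalIntegral.integral_const_mul,
    integral_cos_odd_mul_sin_rpow, integral_sin_odd_mul_sin_rpow hα0 hα2, mul_zero, add_zero]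
  rw [← Finset.mul_sum, ← Finset.mul_sum, ← sum_Gamma_ratio hα0 hα2 n, hΓ, hpow, smul_eq_mul]
  ring

/-- Lemma A.1 of the paper, case `α ≠ 1`: the singular integrals
`I_n(x) = ∫₀^{2π} (sin(nx) − sin(nx−ny)) / (sin(y/2))^α dy` and
`J_n(x) = ∫₀^{2π} (cos(nx) − cos(nx−ny)) / (sin(y/2))^α dy`
equal `β_n sin(nx)` and `β_n cos(nx)` respectively, with the explicit
gamma-function formula for `β_n`. -/
theorem singular_integral_eigenvalues_of_ne_one
    (α : ℝ) (hα0 : 0 < α) (hα2 : α < 2) (hα1 : α ≠ 1)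
    (n : ℕ) (hn : 1 ≤ n) (β : ℝ)
    (hβ : β = 2 ^ α * (2 * π * Gamma (1 - α) / (Gamma (α / 2) * Gamma (1 - α / 2))) *
        (Gamma (α / 2) / Gamma (1 - α / 2) - Gamma (n + α / 2) / Gamma (n + 1 - α / 2))) :
    ∀ x : ℝ,
      (∫ y in (0 : ℝ)..(2 * π),
          (sin (n * x) - sin (n * x - n * y)) / (sin (y / 2)) ^ α) = β * sin (n * x) ∧
      (∫ y in (0 : ℝ)..(2 * π),
          (cos (n * x) - cos (n * x - n * y)) / (sin (y / 2)) ^ α) = β * cos (n * x) := by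
  intro x
  subst hβ
  constructor
  · rw [← integral_singular_kernel hα0 hα2 hα1 n (sin (n * x)) (cos (n * x))]
    congr 1 with y
    rw [sin_sub]
    ring
  · rw [← integral_singular_kernel hα0 hα2 hα1 n (cos (n * x)) (-sin (n * x))]
    congr 1 with y
    rw [cos_sub]
    ring
end

section
/- Let α = 1, and for a positive integer n and x ∈ ℝ set I_n(x) = ∫₀^{2π} (sin(nx) − sin(nx − ny)) / sin(y/2) dy and J_n(x) = ∫₀^{2π} (cos(nx) − cos(nx − ny)) / sin(y/2) dy. Then I_n(x) = β_n sin(nx) and J_n(x) = β_n cos(nx) for all x, where β_n = Σ_{l=1}^{n} 8/(2l − 1). -/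
open Real MeasureTheory intervalIntegral

theorem one_sub_cos_nat_mul_eq (n : ℕ) (y : ℝ) :
    1 - cos (n * y) = (∑ l ∈ Finset.Icc 1 n, 2 * sin (((l : ℝ) - 1 / 2) * y)) * sin (y / 2) := by
  induction n with
  | zero => simp
  | succ k ih =>
    rw [Finset.sum_Icc_succ_top (by omega), add_mul, ← ih]
    have h₁ : ((k + 1 : ℕ) : ℝ) * y = ((k : ℝ) + 1 / 2) * y + y / 2 := by push_cast; ring
    have h₂ : (k : ℝ) * y = ((k : ℝ) + 1 / 2) * y - y / 2 := by ring
    have h₃ : (((k + 1 : ℕ) : ℝ) - 1 / 2) * y = ((k : ℝ) + 1 / 2) * y := by push_cast; ring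
    rw [h₁, h₂, h₃, cos_add, cos_sub]
    ring

theorem sin_nat_mul_eq (n : ℕ) (y : ℝ) :
    sin (n * y) = (∑ l ∈ Finset.Icc 1 n, 2 * cos (((l : ℝ) - 1 / 2) * y)) * sin (y / 2) := by
  induction n with
  | zero => simp
  | succ k ih =>
    rw [Finset.sum_Icc_succ_top (by omega), add_mul, ← ih]
    have h₁ : ((k + 1 : ℕ) : ℝ) * y = ((k : ℝ) + 1 / 2) * y + y / 2 := by push_cast; ring
    have h₂ : (k : ℝ) * y = ((k : ℝ) + 1 / 2) * y - y / 2 := by ring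
    have h₃ : (((k + 1 : ℕ) : ℝ) - 1 / 2) * y = ((k : ℝ) + 1 / 2) * y := by push_cast; ring
    rw [h₁, h₂, h₃, sin_add, sin_sub]
    ring

theorem sin_half_odd_mul_two_pi (l : ℕ) : sin (((l : ℝ) - 1 / 2) * (2 * π)) = 0 := by
  rw [show ((l : ℝ) - 1 / 2) * (2 * π) = l * (2 * π) - π by ring, sin_nat_mul_two_pi_sub, sin_pi,
    neg_zero]

theorem cos_half_odd_mul_two_pi (l : ℕ) : cos (((l : ℝ) - 1 / 2) * (2 * π)) = -1 := by
  rw [show ((l : ℝ) - 1 / 2) * (2 * π) = l * (2 * π) - π by ring, cos_nat_mul_two_pi_sub, cos_pi]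

theorem nat_sub_half_ne_zero {l : ℕ} (hl : 1 ≤ l) : (l : ℝ) - 1 / 2 ≠ 0 := by
  have : (1 : ℝ) ≤ l := by exact_mod_cast hl
  linarith

theorem integral_sum_sin_half_odd (n : ℕ) :
    (∫ y in (0 : ℝ)..(2 * π), ∑ l ∈ Finset.Icc 1 n, 2 * sin (((l : ℝ) - 1 / 2) * y)) =
      ∑ l ∈ Finset.Icc 1 n, 8 / (2 * (l : ℝ) - 1) := by
  rw [intervalIntegral.integral_finsetSum
    fun l _ => Continuous.intervalIntegrable (by fun_prop) _ _]
  refine Finset.sum_congr rfl fun l hl => ?_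
  have h := nat_sub_half_ne_zero (Finset.mem_Icc.mp hl).1
  have h' : 2 * (l : ℝ) - 1 ≠ 0 := fun h₀ => h (by linarith)
  rw [intervalIntegral.integral_const_mul, intervalIntegral.integral_comp_mul_left _ h,
    integral_sin, cos_half_odd_mul_two_pi, mul_zero, cos_zero, smul_eq_mul]
  field_simp
  ring

theorem integral_sum_cos_half_odd (n : ℕ) :
    (∫ y in (0 : ℝ)..(2 * π), ∑ l ∈ Finset.Icc 1 n, 2 * cos (((l : ℝ) - 1 / 2) * y)) = 0 := by
  rw [intervalIntegral.integral_finsetSum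
    fun l _ => Continuous.intervalIntegrable (by fun_prop) _ _]
  refine Finset.sum_eq_zero fun l hl => ?_
  have h := nat_sub_half_ne_zero (Finset.mem_Icc.mp hl).1
  rw [intervalIntegral.integral_const_mul, intervalIntegral.integral_comp_mul_left _ h,
    integral_cos, sin_half_odd_mul_two_pi, mul_zero, sin_zero]
  simp

/-- A combination of `1 - cos (n y)` and `sin (n y)`, divided by `sin (y / 2)`, is a trigonometric
polynomial in `y / 2` away from the endpoints, so its integral can be read off term by term. -/
theorem integral_div_sin_half (n : ℕ) (a b : ℝ) (f : ℝ → ℝ)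
    (hf : ∀ y, f y = a * (1 - cos (n * y)) + b * sin (n * y)) :
    (∫ y in (0 : ℝ)..(2 * π), f y / sin (y / 2)) =
      (∑ l ∈ Finset.Icc 1 n, 8 / (2 * (l : ℝ) - 1)) * a := by
  have hpi : (0 : ℝ) ≤ 2 * π := by positivity
  have hcongr : (∫ y in (0 : ℝ)..(2 * π), f y / sin (y / 2)) =
      ∫ y in (0 : ℝ)..(2 * π),
        (a * ∑ l ∈ Finset.Icc 1 n, 2 * sin (((l : ℝ) - 1 / 2) * y)) +
          b * ∑ l ∈ Finset.Icc 1 n, 2 * cos (((l : ℝ) - 1 / 2) * y) := by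
    refine intervalIntegral.integral_congr_Ioo_of_le hpi fun y hy => ?_
    have hs : sin (y / 2) ≠ 0 :=
      (sin_pos_of_pos_of_lt_pi (by linarith [hy.1]) (by linarith [hy.2])).ne'
    rw [div_eq_iff hs, hf, one_sub_cos_nat_mul_eq, sin_nat_mul_eq]
    ring
  rw [hcongr, intervalIntegral.integral_add
    (Continuous.intervalIntegrable (by fun_prop) _ _)
    (Continuous.intervalIntegrable (by fun_prop) _ _), intervalIntegral.integral_const_mul,
    intervalIntegral.integral_const_mul, integral_sum_sin_half_odd, integral_sum_cos_half_odd]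
  ring

/-- Lemma A.1 of the paper, case `α = 1`: the singular integrals
`I_n(x) = ∫₀^{2π} (sin(nx) − sin(nx−ny)) / sin(y/2) dy` and
`J_n(x) = ∫₀^{2π} (cos(nx) − cos(nx−ny)) / sin(y/2) dy`
equal `β_n sin(nx)` and `β_n cos(nx)` respectively, with
`β_n = Σ_{l=1}^{n} 8/(2l−1)`. -/
theorem singular_integral_eigenvalues_of_eq_one
    (n : ℕ) (hn : 1 ≤ n) (β : ℝ)
    (hβ : β = ∑ l ∈ Finset.Icc 1 n, 8 / (2 * (l : ℝ) - 1)) :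
    ∀ x : ℝ,
      (∫ y in (0 : ℝ)..(2 * π),
          (sin (n * x) - sin (n * x - n * y)) / sin (y / 2)) = β * sin (n * x) ∧
      (∫ y in (0 : ℝ)..(2 * π),
          (cos (n * x) - cos (n * x - n * y)) / sin (y / 2)) = β * cos (n * x) := by
  intro x
  subst hβ
  refine ⟨integral_div_sin_half n _ (cos (n * x)) _ fun y => ?_,
    integral_div_sin_half n _ (-sin (n * x)) _ fun y => ?_⟩
  · rw [sin_sub]
    ring
  · rw [cos_sub]
    ring
end

section
/- Let 0 < α < 2 with α ≠ 1 and define β_n = 2^α · (2π Γ(1−α))/(Γ(α/2) Γ(1−α/2)) · ( Γ(α/2)/Γ(1−α/2) − Γ(n+α/2)/Γ(n+1−α/2) ) for positive integers n. Then the sequence (β_n) is strictly increasing in n, i.e. β_n < β_{n+1} for every n ≥ 1. -/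
open Real

/-- Lemma A.1 of the paper, monotonicity part (case `α ≠ 1`): the sequence
`β_n = 2^α · (2π Γ(1−α))/(Γ(α/2) Γ(1−α/2)) · (Γ(α/2)/Γ(1−α/2) − Γ(n+α/2)/Γ(n+1−α/2))`
is strictly increasing in `n ≥ 1`. -/
theorem beta_strictMono_of_ne_one
    (α : ℝ) (hα0 : 0 < α) (hα2 : α < 2) (hα1 : α ≠ 1) (β : ℕ → ℝ)
    (hβ : ∀ n : ℕ, β n =
        2 ^ α * (2 * π * Gamma (1 - α) / (Gamma (α / 2) * Gamma (1 - α / 2))) *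
          (Gamma (α / 2) / Gamma (1 - α / 2) - Gamma (n + α / 2) / Gamma (n + 1 - α / 2))) :
    ∀ n : ℕ, 1 ≤ n → β n < β (n + 1) := by
  intro n _
  have hn : (0 : ℝ) ≤ n := n.cast_nonneg
  have hx : 0 < (n : ℝ) + α / 2 := by linarith
  have hy : 0 < (n : ℝ) + 1 - α / 2 := by linarith
  have h₁ : Gamma ((n + 1 : ℕ) + α / 2) = (n + α / 2) * Gamma (n + α / 2) := by
    rw [← Gamma_add_one hx.ne']
    push_cast
    ring_nf
  have h₂ : Gamma ((n + 1 : ℕ) + 1 - α / 2) = (n + 1 - α / 2) * Gamma (n + 1 - α / 2) := by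
    rw [← Gamma_add_one hy.ne']
    push_cast
    ring_nf
  have h₃ : Gamma (2 - α) = (1 - α) * Gamma (1 - α) := by
    rw [← Gamma_add_one (sub_ne_zero.mpr hα1.symm)]
    ring_nf
  have hG : 0 < Gamma (2 - α) := Gamma_pos_of_pos (by linarith)
  have hA : 0 < Gamma (α / 2) := Gamma_pos_of_pos (by linarith)
  have hB : 0 < Gamma (1 - α / 2) := Gamma_pos_of_pos (by linarith)
  have hX : 0 < Gamma (n + α / 2) := Gamma_pos_of_pos hx
  have hY : 0 < Gamma (n + 1 - α / 2) := Gamma_pos_of_pos hy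
  have hdiff : β (n + 1) - β n =
      2 ^ α * (2 * π * Gamma (2 - α) / (Gamma (α / 2) * Gamma (1 - α / 2))) *
        (Gamma (n + α / 2) / ((n + 1 - α / 2) * Gamma (n + 1 - α / 2))) := by
    have hratio : Gamma (n + α / 2) / Gamma (n + 1 - α / 2) =
        (n + 1 - α / 2) * (Gamma (n + α / 2) / ((n + 1 - α / 2) * Gamma (n + 1 - α / 2))) := by
      rw [← mul_div_assoc, mul_div_mul_left _ _ hy.ne']
    rw [hβ, hβ, h₁, h₂, h₃, hratio]
    ring
  have hpos : 0 < β (n + 1) - β n := by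
    rw [hdiff]
    positivity
  exact sub_pos.mp hpos
end

section
/- Let 1 < α < 2 and define β_n = 2^α · (2π Γ(1−α))/(Γ(α/2) Γ(1−α/2)) · ( Γ(α/2)/Γ(1−α/2) − Γ(n+α/2)/Γ(n+1−α/2) ) for positive integers n. Then there exist constants c > 0 and C > 0 such that c·n^{α−1} ≤ β_n ≤ C·n^{α−1} for every integer n ≥ 1. -/
open Real

/-- Wendel's inequality. -/
theorem Gamma_add_le_rpow_mul_Gamma {x s : ℝ} (hx : 0 < x) (hs0 : 0 < s) (hs1 : s < 1) :
    Gamma (x + s) ≤ x ^ s * Gamma x := by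
  have hG := Gamma_pos_of_pos hx
  have h := Gamma_mul_add_mul_le_rpow_Gamma_mul_rpow_Gamma hx (by linarith : 0 < x + 1)
    (by linarith : 0 < 1 - s) hs0 (by ring)
  rw [show (1 - s) * x + s * (x + 1) = x + s by ring, Gamma_add_one hx.ne',
    mul_rpow hx.le hG.le] at h
  calc Gamma (x + s) ≤ Gamma x ^ (1 - s) * (x ^ s * Gamma x ^ s) := h
    _ = x ^ s * (Gamma x ^ (1 - s) * Gamma x ^ s) := by ring
    _ = x ^ s * Gamma x := by rw [← rpow_add hG]; simp

theorem Gamma_ratio_add_one {a y : ℝ} (h0 : 0 < y + a) (h1 : 0 < y + 1 - a) :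
    Gamma (y + 1 + a) / Gamma (y + 1 + 1 - a) =
      (y + a) / (y + 1 - a) * (Gamma (y + a) / Gamma (y + 1 - a)) := by
  rw [show y + 1 + a = (y + a) + 1 by ring, show y + 1 + 1 - a = (y + 1 - a) + 1 by ring,
    Gamma_add_one h0.ne', Gamma_add_one h1.ne', mul_div_mul_comm]

theorem Gamma_ratio_one_le {a : ℝ} (ha0 : 1 / 2 < a) (ha1 : a < 1) {n : ℕ} (hn : 1 ≤ n) :
    a / (1 - a) * (Gamma a / Gamma (1 - a)) ≤ Gamma (n + a) / Gamma (n + 1 - a) := by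
  induction n, hn using Nat.le_induction with
  | base =>
    have h := Gamma_ratio_add_one (a := a) (y := 0) (by linarith) (by linarith)
    simp only [zero_add] at h
    rw [Nat.cast_one, h]
  | succ m hm ih =>
    have hm' : (1 : ℝ) ≤ m := by exact_mod_cast hm
    have hp : 0 < (m : ℝ) + 1 - a := by linarith
    push_cast
    rw [Gamma_ratio_add_one (by linarith) hp]
    refine ih.trans (le_mul_of_one_le_left ?_ ?_)
    · exact (div_pos (Gamma_pos_of_pos (by linarith)) (Gamma_pos_of_pos hp)).le
    · rw [one_le_div hp]
      linarith

theorem Gamma_ratio_le {a x : ℝ} (ha0 : 1 / 2 < a) (ha1 : a < 1) (hx : 1 ≤ x) :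
    Gamma (x + a) / Gamma (x + 1 - a) ≤ 2 * x ^ (2 * a - 1) := by
  have hp : 0 < x + 1 - a := by linarith
  have h := Gamma_add_le_rpow_mul_Gamma hp (by linarith : 0 < 2 * a - 1) (by linarith)
  rw [show x + 1 - a + (2 * a - 1) = x + a by ring] at h
  rw [div_le_iff₀ (Gamma_pos_of_pos hp)]
  refine h.trans (mul_le_mul_of_nonneg_right ?_ (Gamma_pos_of_pos hp).le)
  calc (x + 1 - a) ^ (2 * a - 1) ≤ (2 * x) ^ (2 * a - 1) :=
        rpow_le_rpow hp.le (by linarith) (by linarith)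
    _ = 2 ^ (2 * a - 1) * x ^ (2 * a - 1) := mul_rpow (by norm_num) (by linarith)
    _ ≤ 2 * x ^ (2 * a - 1) := by
        gcongr
        exact rpow_le_self_of_one_le (by norm_num) (by linarith)

theorem le_Gamma_ratio {a x : ℝ} (ha0 : 1 / 2 < a) (ha1 : a < 1) (hx : 1 ≤ x) :
    1 / 2 * x ^ (2 * a - 1) ≤ Gamma (x + a) / Gamma (x + 1 - a) := by
  have hp : 0 < x + 1 - a := by linarith
  have hq : 0 < x + a := by linarith
  have hG := Gamma_pos_of_pos hp
  have h := Gamma_add_le_rpow_mul_Gamma hq (by linarith : 0 < 2 - 2 * a) (by linarith)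
  rw [show x + a + (2 - 2 * a) = (x + 1 - a) + 1 by ring, Gamma_add_one hp.ne'] at h
  have hmono : x ^ (2 * a - 1) ≤ (x + a) ^ (2 * a - 1) :=
    rpow_le_rpow (by linarith) (by linarith) (by linarith)
  have hmul : (x + a) ^ (2 * a - 1) * (x + a) ^ (2 - 2 * a) = x + a := by
    rw [← rpow_add hq, show 2 * a - 1 + (2 - 2 * a) = 1 by ring, rpow_one]
  have hw : 0 < (x + a) ^ (2 - 2 * a) := rpow_pos_of_pos hq _
  rw [le_div_iff₀ hG]
  refine le_of_mul_le_mul_left ?_ hw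
  calc (x + a) ^ (2 - 2 * a) * (1 / 2 * x ^ (2 * a - 1) * Gamma (x + 1 - a))
      ≤ (x + a) ^ (2 - 2 * a) * (1 / 2 * (x + a) ^ (2 * a - 1) * Gamma (x + 1 - a)) := by gcongr
    _ = 1 / 2 * ((x + a) ^ (2 * a - 1) * (x + a) ^ (2 - 2 * a)) * Gamma (x + 1 - a) := by ring
    _ = 1 / 2 * (x + a) * Gamma (x + 1 - a) := by rw [hmul]
    _ ≤ (x + 1 - a) * Gamma (x + 1 - a) := by
        gcongr
        linarith
    _ ≤ _ := h

/-- Lemma A.1 of the paper, asymptotics for `1 < α < 2`: the sequence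
`β_n = 2^α · (2π Γ(1−α))/(Γ(α/2) Γ(1−α/2)) · (Γ(α/2)/Γ(1−α/2) − Γ(n+α/2)/Γ(n+1−α/2))`
satisfies `c·n^{α−1} ≤ β_n ≤ C·n^{α−1}` for all `n ≥ 1`. -/
theorem beta_power_asymptotics_of_gt_one
    (α : ℝ) (hα1 : 1 < α) (hα2 : α < 2) (β : ℕ → ℝ)
    (hβ : ∀ n : ℕ, β n =
        2 ^ α * (2 * π * Gamma (1 - α) / (Gamma (α / 2) * Gamma (1 - α / 2))) *
          (Gamma (α / 2) / Gamma (1 - α / 2) - Gamma (n + α / 2) / Gamma (n + 1 - α / 2))) :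
    ∃ c > (0 : ℝ), ∃ C > (0 : ℝ), ∀ n : ℕ, 1 ≤ n →
      c * (n : ℝ) ^ (α - 1) ≤ β n ∧ β n ≤ C * (n : ℝ) ^ (α - 1) := by
  obtain ⟨a, rfl⟩ : ∃ a, α = 2 * a := ⟨α / 2, by ring⟩
  have ha0 : 1 / 2 < a := by linarith
  have ha1 : a < 1 := by linarith
  simp only [mul_div_cancel_left₀ a (two_ne_zero' ℝ)] at hβ
  have hΓ : Gamma (1 - 2 * a) < 0 := by
    have h1 : Gamma (1 - 2 * a + 1) = (1 - 2 * a) * Gamma (1 - 2 * a) :=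
      Gamma_add_one (by linarith)
    have h2 : 0 < Gamma (1 - 2 * a + 1) := Gamma_pos_of_pos (by linarith)
    rw [h1] at h2
    exact neg_of_mul_pos_right h2 (by linarith)
  have hA : 0 < Gamma a := Gamma_pos_of_pos (by linarith)
  have hB : 0 < Gamma (1 - a) := Gamma_pos_of_pos (by linarith)
  obtain ⟨K, hK⟩ : ∃ K, K =
    -((2 : ℝ) ^ (2 * a) * (2 * π * Gamma (1 - 2 * a) / (Gamma a * Gamma (1 - a)))) := ⟨_, rfl⟩
  have hKpos : 0 < K := by
    rw [hK, neg_pos]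
    refine mul_neg_of_pos_of_neg (by positivity) (div_neg_of_neg_of_pos ?_ (by positivity))
    exact mul_neg_of_pos_of_neg (by positivity) hΓ
  have hδ : 0 < (2 * a - 1) / a := div_pos (by linarith) (by linarith)
  refine ⟨K * ((2 * a - 1) / a * (1 / 2)), by positivity, K * 2, by positivity, fun n hn => ?_⟩
  have hn' : (1 : ℝ) ≤ n := by exact_mod_cast hn
  have hβn : β n = K * (Gamma (n + a) / Gamma (n + 1 - a) - Gamma a / Gamma (1 - a)) := by
    rw [hβ, hK]; ring
  have h1 := Gamma_ratio_one_le ha0 ha1 hn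
  have hu := Gamma_ratio_le ha0 ha1 hn'
  have hl := le_Gamma_ratio ha0 ha1 hn'
  have hg0 : 0 < Gamma a / Gamma (1 - a) := div_pos hA hB
  rw [hβn, mul_assoc K, mul_assoc K]
  generalize Gamma a / Gamma (1 - a) = g₀ at *
  generalize Gamma (n + a) / Gamma (n + 1 - a) = g at *
  refine ⟨mul_le_mul_of_nonneg_left ?_ hKpos.le, mul_le_mul_of_nonneg_left ?_ hKpos.le⟩
  · have h2 : g₀ ≤ (1 - a) / a * g := by
      rw [div_mul_eq_mul_div, div_le_iff₀ (by linarith)] at h1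
      rw [div_mul_eq_mul_div, le_div_iff₀ (by linarith)]
      linarith
    calc (2 * a - 1) / a * (1 / 2) * (n : ℝ) ^ (2 * a - 1)
        = (2 * a - 1) / a * (1 / 2 * (n : ℝ) ^ (2 * a - 1)) := by ring
      _ ≤ (2 * a - 1) / a * g := by gcongr
      _ = g - (1 - a) / a * g := by field_simp; ring
      _ ≤ g - g₀ := by linarith
  · linarith
end

section
/- Stationary tripole equilibrium: let α ∈ [1,2), γ ≠ 0, and a ∈ (0,1). Set w₁ = (1, 0), w₂ = (0, 0), w₃ = (−a, 0) ∈ ℝ², γ₁ = γ, γ₂ = −γ (a/(a+1))^{α+1}, γ₃ = γ a^{α+1}. Then for each i ∈ {1, 2, 3}: Σ_{j ≠ i} γ_j (w_i − w_j)/|w_i − w_j|^{α+2} = 0, i.e. the three point vortices form a stationary configuration of the gSQG point-vortex system. -/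
open Real

/-- A point of the Euclidean plane `ℝ²` given by its two coordinates. -/
noncomputable def planePt (x y : ℝ) : EuclideanSpace ℝ (Fin 2) :=
  (WithLp.equiv 2 (Fin 2 → ℝ)).symm ![x, y]

theorem planePt_zero_sub (x y : ℝ) : planePt x 0 - planePt y 0 = planePt (x - y) 0 := by
  ext i
  fin_cases i <;> simp [planePt]

theorem smul_planePt_zero (c x : ℝ) : c • planePt x 0 = planePt (c * x) 0 := by
  ext i
  fin_cases i <;> simp [planePt]

theorem planePt_zero_add (x y : ℝ) : planePt x 0 + planePt y 0 = planePt (x + y) 0 := by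
  ext i
  fin_cases i <;> simp [planePt]

theorem planePt_zero_zero : planePt 0 0 = 0 := by
  ext i
  fin_cases i <;> simp [planePt]

theorem norm_planePt_zero (x : ℝ) : ‖planePt x 0‖ = |x| := by
  simp [EuclideanSpace.norm_eq, planePt, Real.sqrt_sq_eq_abs]

/-- Stationary tripole equilibrium (§5.3 of the paper): with `w₁ = (1,0)`,
`w₂ = (0,0)`, `w₃ = (−a,0)` and circulations `γ`, `−γ(a/(a+1))^{α+1}`,
`γ a^{α+1}`, the three point vortices form a stationary configuration of the
gSQG point-vortex system: `Σ_{j≠i} γ_j (w_i−w_j)/|w_i−w_j|^{α+2} = 0` for each `i`. -/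
theorem stationary_tripole_equilibrium
    (α γ a : ℝ) (hα1 : 1 ≤ α) (hα2 : α < 2) (hγ : γ ≠ 0) (ha0 : 0 < a) (ha1 : a < 1)
    (w : Fin 3 → EuclideanSpace ℝ (Fin 2)) (γv : Fin 3 → ℝ)
    (hw0 : w 0 = planePt 1 0) (hw1 : w 1 = planePt 0 0) (hw2 : w 2 = planePt (-a) 0)
    (hγ0 : γv 0 = γ) (hγ1 : γv 1 = -γ * (a / (a + 1)) ^ (α + 1))
    (hγ2 : γv 2 = γ * a ^ (α + 1)) :
    ∀ i, ∑ j ∈ Finset.univ.erase i,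
        γv j • ((‖w i - w j‖ ^ (α + 2))⁻¹ • (w i - w j)) = 0 := by
  have hb : 0 < a + 1 := by linarith
  have hpa : a ^ (α + 2) = a ^ (α + 1) * a := by
    rw [← rpow_add_one ha0.ne']
    ring_nf
  have hpb : (a + 1) ^ (α + 2) = (a + 1) ^ (α + 1) * (a + 1) := by
    rw [← rpow_add_one hb.ne']
    ring_nf
  have hA : a ^ (α + 1) ≠ 0 := (rpow_pos_of_pos ha0 _).ne'
  have hB : (a + 1) ^ (α + 1) ≠ 0 := (rpow_pos_of_pos hb _).ne'
  have n01 : |(1 : ℝ) - 0| = 1 := by simp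
  have n10 : |(0 : ℝ) - 1| = 1 := by simp
  have n02 : |1 - -a| = a + 1 := by rw [abs_of_pos] <;> linarith
  have n20 : |-a - 1| = a + 1 := by rw [abs_of_neg] <;> linarith
  have n12 : |0 - -a| = a := by rw [abs_of_pos] <;> linarith
  have n21 : |-a - 0| = a := by rw [abs_of_neg] <;> linarith
  have e0 : (Finset.univ : Finset (Fin 3)).erase 0 = {1, 2} := by decide
  have e1 : (Finset.univ : Finset (Fin 3)).erase 1 = {0, 2} := by decide
  have e2 : (Finset.univ : Finset (Fin 3)).erase 2 = {0, 1} := by decide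
  have key : ∀ i j k : Fin 3, j ≠ k → Finset.univ.erase i = {j, k} →
      ∀ x y z : ℝ, w i = planePt x 0 → w j = planePt y 0 → w k = planePt z 0 →
      γv j * ((|x - y| ^ (α + 2))⁻¹ * (x - y)) + γv k * ((|x - z| ^ (α + 2))⁻¹ * (x - z)) = 0 →
      ∑ l ∈ Finset.univ.erase i, γv l • ((‖w i - w l‖ ^ (α + 2))⁻¹ • (w i - w l)) = 0 := by
    intro i j k hjk he x y z hx hy hz h
    rw [he, Finset.sum_pair hjk, hx, hy, hz]
    simp only [planePt_zero_sub, norm_planePt_zero, smul_planePt_zero, planePt_zero_add, h,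
      planePt_zero_zero]
  have hdiv : (a / (a + 1)) ^ (α + 1) = a ^ (α + 1) / (a + 1) ^ (α + 1) :=
    div_rpow ha0.le hb.le _
  intro i
  fin_cases i
  · refine key 0 1 2 (by decide) e0 _ _ _ hw0 hw1 hw2 ?_
    rw [n01, n02, hγ1, hγ2, hdiv, hpb, one_rpow]
    field_simp
    ring
  · refine key 1 0 2 (by decide) e1 _ _ _ hw1 hw0 hw2 ?_
    rw [n10, n12, hγ0, hγ2, hpa, one_rpow]
    field_simp
    ring
  · refine key 2 0 1 (by decide) e2 _ _ _ hw2 hw0 hw1 ?_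
    rw [n20, n21, hγ0, hγ1, hdiv, hpa, hpb]
    field_simp
    ring
end

section
/- Non-degeneracy of the stationary tripole: let α ∈ [1,2), γ ≠ 0, and a > 0. The 6 × 3 real matrix with rows r₁ = (−(α+1) a^{α+1} (a+1)^{−α−2}, 0, −1/γ), r₂ = (0, a^{α+1} (a+1)^{−α−2}, 0), r₃ = (−(α+1)/a, 0, 0), r₄ = (0, 1/a, 0), r₅ = (−(α+1) a^{−1} (a+1)^{−α−2}, 0, a^{−α−1}/γ), r₆ = (0, a^{−1} (a+1)^{−α−2}, 0) has rank 3. -/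
open Real

/-- Non-degeneracy of the stationary tripole (§5.3 of the paper): the 6 × 3
differential matrix of the point-vortex map at the stationary tripole
configuration has full rank 3. -/
theorem stationary_tripole_nondegenerate
    (α γ a : ℝ) (hα1 : 1 ≤ α) (hα2 : α < 2) (hγ : γ ≠ 0) (ha : 0 < a) :
    (!![-(α + 1) * a ^ (α + 1) * (a + 1) ^ (-α - 2), 0, -1 / γ;
        0, a ^ (α + 1) * (a + 1) ^ (-α - 2), 0;
        -(α + 1) / a, 0, 0;
        0, 1 / a, 0;
        -(α + 1) * a⁻¹ * (a + 1) ^ (-α - 2), 0, a ^ (-α - 1) / γ;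
        0, a⁻¹ * (a + 1) ^ (-α - 2), 0] : Matrix (Fin 6) (Fin 3) ℝ).rank = 3 := by
  have ha0 : a ≠ 0 := ha.ne'
  have hα0 : -(α + 1) ≠ 0 := by linarith
  rw [← Matrix.rank_transpose]
  refine (LinearIndependent.rank_matrix ?_).trans (Fintype.card_fin 3)
  refine Matrix.mulVec_injective_iff.mp
    ((injective_iff_map_eq_zero (Matrix.mulVecLin _)).mpr fun v hv => ?_)
  have h0 := congrFun hv 0
  have h2 := congrFun hv 2
  have h3 := congrFun hv 3
  simp only [Matrix.mulVecLin_apply, Matrix.mulVec, dotProduct, Fin.sum_univ_three, Matrix.of_apply,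
    Matrix.cons_val, Pi.zero_apply, zero_mul, add_zero, zero_add] at h0 h2 h3
  have hv0 : v 0 = 0 := (mul_eq_zero.mp h2).resolve_left (div_ne_zero hα0 ha0)
  have hv1 : v 1 = 0 := (mul_eq_zero.mp h3).resolve_left (one_div_ne_zero ha0)
  rw [hv0, mul_zero, zero_add] at h0
  have hv2 : v 2 = 0 :=
    (mul_eq_zero.mp h0).resolve_left (div_ne_zero (neg_ne_zero.mpr one_ne_zero) hγ)
  ext i
  fin_cases i
  exacts [hv0, hv1, hv2]
end
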